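/- There is an absolute constant C > 0 with the following property. Let X ≥ Y > 0, let θ ∈ (0, π/4), set ψ = Y/X and M = ⌊θ/(2ψ)⌋, let R₀ = [−X/2, X/2] × [−Y/2, Y/2], and for each integer j with −M ≤ j ≤ M let R_j be the image of R₀ under the rotation of ℝ² by angle jψ about the origin. Then for every m ∈ ℝ² with |m| ≥ Y, the number of indices j ∈ {−M, …, M} such that m ∈ R_j is at most C·X/|m|. -/

import Mathlib

open Real Set

noncomputable section

/-- Rotation of the plane by angle `β` about the origin. -/
def rot (β : ℝ) (p : ℝ × ℝ) : ℝ × ℝ :=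
  (p.1 * Real.cos β - p.2 * Real.sin β, p.1 * Real.sin β + p.2 * Real.cos β)

/-- Euclidean length `|m|` of a plane vector. -/
def nrm (m : ℝ × ℝ) : ℝ := Real.sqrt (m.1 ^ 2 + m.2 ^ 2)

lemma rot_nrm (a : ℝ) (p : ℝ × ℝ) : nrm (rot a p) ^ 2 = p.1 ^ 2 + p.2 ^ 2 := by
  unfold nrm rot
  rw [Real.sq_sqrt (by positivity)]
  have := Real.sin_sq_add_cos_sq a
  linear_combination (p.1 ^ 2 + p.2 ^ 2) * this

lemma rot_sin (a b : ℝ) (p q : ℝ × ℝ) (h : rot a p = rot b q) :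
    (nrm (rot a p)) ^ 2 * Real.sin (b - a) = p.2 * q.1 - p.1 * q.2 := by
  have hq : nrm (rot a p) ^ 2 = q.1 ^ 2 + q.2 ^ 2 := by rw [h, rot_nrm]
  rw [hq, Real.sin_sub]
  unfold rot at h
  rw [Prod.mk.injEq] at h
  obtain ⟨h1, h2⟩ := h
  have ha := Real.sin_sq_add_cos_sq a
  have e1 : p.1 = (q.1 * cos b - q.2 * sin b) * cos a + (q.1 * sin b + q.2 * cos b) * sin a := by
    rw [← h1, ← h2]; linear_combination (-p.1) * ha
  have e2 : p.2 = (q.1 * sin b + q.2 * cos b) * cos a - (q.1 * cos b - q.2 * sin b) * sin a := by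
    rw [← h1, ← h2]; linear_combination (-p.2) * ha
  rw [e1, e2]
  ring

/-- Two indices whose rectangles share the point are close. -/
lemma angle_bound (Y a b n : ℝ) (p q : ℝ × ℝ) (h : rot a p = rot b q)
    (hn : nrm (rot a p) = n) (hn0 : 0 < n) (hp : |p.2| ≤ Y / 2) (hq : |q.2| ≤ Y / 2)
    (h0 : 0 ≤ b - a) (h1 : b - a ≤ π / 2) : (b - a) * n ≤ 2 * Y := by
  have hs := rot_sin a b p q h
  have np := rot_nrm a p
  have nq := rot_nrm b q
  rw [← h] at nq
  rw [hn] at hs np nq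
  have p1 : |p.1| ≤ n := abs_le_of_sq_le_sq (by nlinarith [sq_nonneg p.2]) hn0.le
  have q1 : |q.1| ≤ n := abs_le_of_sq_le_sq (by nlinarith [sq_nonneg q.2]) hn0.le
  have hj := Real.mul_le_sin h0 h1
  have b1 : p.2 * q.1 - p.1 * q.2 ≤ Y * n := by
    have u1 : p.2 * q.1 ≤ (Y / 2) * n := by
      calc p.2 * q.1 ≤ |p.2 * q.1| := le_abs_self _
        _ = |p.2| * |q.1| := abs_mul _ _
        _ ≤ _ := by gcongr; exact (abs_nonneg _).trans hp
    have u2 : -(p.1 * q.2) ≤ n * (Y / 2) := by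
      calc -(p.1 * q.2) ≤ |p.1 * q.2| := neg_le_abs _
        _ = |p.1| * |q.2| := abs_mul _ _
        _ ≤ _ := by gcongr
    linarith
  have b2 : n * Real.sin (b - a) ≤ Y := by
    rw [← hs] at b1
    nlinarith
  have b3 : (1 / 2) * (b - a) ≤ Real.sin (b - a) := by
    refine le_trans ?_ hj
    refine mul_le_mul_of_nonneg_right ?_ h0
    rw [div_le_div_iff₀ (by norm_num) Real.pi_pos]
    linarith [Real.pi_le_four]
  nlinarith

/-- **Counting lemma.** There is an absolute constant `C > 0` such that: for `X ≥ Y > 0`,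
`θ ∈ (0, π/4)`, `ψ = Y/X`, `M = ⌊θ/(2ψ)⌋`, `R₀ = [-X/2, X/2] × [-Y/2, Y/2]` and
`R_j = r_{jψ}(R₀)`, every `m ∈ ℝ²` with `|m| ≥ Y` lies in at most `C·X/|m|` of the
rectangles `R_j`, `-M ≤ j ≤ M`. -/
theorem rotated_rectangle_covering_bound :
    ∃ C > (0:ℝ), ∀ X Y θ : ℝ, 0 < Y → Y ≤ X → θ ∈ Set.Ioo 0 (π/4) →
      ∀ m : ℝ × ℝ, Y ≤ nrm m →
        ({j : ℤ | -⌊θ / (2 * (Y / X))⌋ ≤ j ∧ j ≤ ⌊θ / (2 * (Y / X))⌋ ∧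
            m ∈ rot ((j : ℝ) * (Y / X)) ''
              (Set.Icc (-(X/2)) (X/2) ×ˢ Set.Icc (-(Y/2)) (Y/2))}.ncard : ℝ)
          ≤ C * X / nrm m := by
  refine ⟨3, by norm_num, ?_⟩
  intro X Y θ hY hYX hθ m hm
  have hX : 0 < X := hY.trans_le hYX
  have hn0 : 0 < nrm m := hY.trans_le hm
  have hψ : 0 < Y / X := by positivity
  set M := ⌊θ / (2 * (Y / X))⌋ with hM
  have hMle : (M : ℝ) * (2 * (Y / X)) ≤ θ := by
    rw [← le_div_iff₀ (by positivity)]; exact Int.floor_le _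
  set S := {j : ℤ | -M ≤ j ∧ j ≤ M ∧ m ∈ rot ((j : ℝ) * (Y / X)) ''
              (Set.Icc (-(X/2)) (X/2) ×ˢ Set.Icc (-(Y/2)) (Y/2))} with hS
  have hfin : S.Finite := (Set.finite_Icc (-M) M).subset fun j hj => ⟨hj.1, hj.2.1⟩
  rcases S.eq_empty_or_nonempty with he | hne
  · rw [he, Set.ncard_empty]
    push_cast
    positivity
  obtain ⟨a, haS, hmin⟩ := Set.exists_min_image S id hfin hne
  obtain ⟨ha1, ha2, p, hp, hpm⟩ := haS
  obtain ⟨⟨hp1, hp2⟩, hp3, hp4⟩ := hp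
  have hnX : nrm m ≤ X := by
    have h := rot_nrm ((a : ℝ) * (Y / X)) p
    rw [hpm] at h
    have : nrm m ^ 2 ≤ X ^ 2 := by rw [h]; nlinarith
    exact le_of_sq_le_sq this hX.le
  have hsub : S ⊆ (Finset.Icc a (a + ⌊2 * X / nrm m⌋) : Finset ℤ) := by
    intro j hj
    have haj : a ≤ j := hmin j hj
    obtain ⟨hj1, hj2, q, hq, hqm⟩ := hj
    obtain ⟨-, hq3, hq4⟩ := hq
    rw [Finset.coe_Icc]
    refine ⟨haj, ?_⟩
    have hajR : (a : ℝ) ≤ j := by exact_mod_cast haj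
    have hjM : (j : ℝ) ≤ M := by exact_mod_cast hj2
    have haM : -(M : ℝ) ≤ a := by exact_mod_cast ha1
    have key := angle_bound Y ((a : ℝ) * (Y / X)) ((j : ℝ) * (Y / X)) (nrm m) p q
      (hpm.trans hqm.symm) (by rw [hpm]) hn0 (abs_le.2 ⟨hp3, hp4⟩) (abs_le.2 ⟨hq3, hq4⟩)
      (by nlinarith) (by nlinarith [hθ.2, Real.pi_pos])
    have : j - a ≤ ⌊2 * X / nrm m⌋ := by
      rw [Int.le_floor, le_div_iff₀ hn0]
      push_cast
      have e : ((j : ℝ) * (Y / X) - a * (Y / X)) * nrm m = ((j - a) * nrm m) * Y / X := by ring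
      rw [e, div_le_iff₀ hX] at key
      nlinarith
    linarith
  have hc := Set.ncard_le_ncard hsub (Finset.finite_toSet _)
  rw [Set.ncard_coe_finset, Int.card_Icc] at hc
  have hfl : 0 ≤ ⌊2 * X / nrm m⌋ := Int.floor_nonneg.2 (by positivity)
  have hc2 : (S.ncard : ℤ) ≤ ⌊2 * X / nrm m⌋ + 1 := by omega
  have hc3 : (S.ncard : ℝ) ≤ (⌊2 * X / nrm m⌋ : ℝ) + 1 := by exact_mod_cast hc2
  have h1 : 1 ≤ X / nrm m := (one_le_div hn0).2 hnX
  have h2 := Int.floor_le (2 * X / nrm m)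
  have e2 : 2 * X / nrm m = 2 * (X / nrm m) := by ring
  have e3 : 3 * X / nrm m = 3 * (X / nrm m) := by ring
  rw [e3]
  rw [e2] at h2 hc3
  linarith
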